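/- arXiv:2407.20781 — 3 statements merged into one kernel-verified Lean document; each statement's English description precedes it below -/
import Mathlib

section
/- Let K, F be totally real number fields with F ⊆ K and [K : F] = d. The following are equivalent: (1) there exists a totally positive definite quadratic O_F-lattice L such that L ⊗_{O_F} O_K is universal over O_K; (2) every element of O_K^+ is F-representable; (3) every indecomposable element of O_K^+ is F-representable. -/
open scoped NumberField TensorProduct
open Finset

noncomputable section

/-- An element of a field is *totally positive* if every real embedding sends it to a
positive real number. -/
def TPos {F : Type*} [Field F] (x : F) : Prop := ∀ σ : F →+* ℝ, 0 < σ x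

/-- `TNonneg x` (`x ⪰ 0`) : every real embedding sends `x` to a nonnegative real. -/
def TNonneg {F : Type*} [Field F] (x : F) : Prop := ∀ σ : F →+* ℝ, 0 ≤ σ x

/-- `TLe x y` (`x ⪯ y`) : every real embedding `σ` satisfies `σ x ≤ σ y`. -/
def TLe {F : Type*} [Field F] (x y : F) : Prop := ∀ σ : F →+* ℝ, σ x ≤ σ y

/-- A field is *totally real* if every embedding into `ℂ` has real image. -/
def IsTotallyRealField (F : Type*) [Field F] : Prop :=
  ∀ σ : F →+* ℂ, ∀ x : F, (σ x).im = 0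

/-- A quadratic `𝓞 F`-lattice `(L, Q)` is *totally positive definite* if `Q v` is totally
positive for every nonzero `v`. -/
def IsTotallyPositiveDefinite {F : Type*} [Field F] {L : Type*} [AddCommGroup L]
    [Module (𝓞 F) L] (Q : QuadraticMap (𝓞 F) L F) : Prop :=
  ∀ v : L, v ≠ 0 → TPos (Q v)

/-- The value of the `𝓞 K`-quadratic extension of `Q` to `L ⊗[𝓞 F] 𝓞 K`
at the element `∑ i, (c i) ⊗ (v i)`. -/
def ExtVal {F K : Type*} [Field F] [Field K] [Algebra F K] {L : Type*} [AddCommGroup L]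
    [Module (𝓞 F) L] (Q : QuadraticMap (𝓞 F) L F) {n : ℕ}
    (c : Fin n → 𝓞 K) (v : Fin n → L) : K :=
  (∑ i, (c i : K) ^ 2 * algebraMap F K (Q (v i))) +
    ∑ i, ∑ j, if i < j
      then (c i : K) * (c j : K) * algebraMap F K (QuadraticMap.polar (⇑Q) (v i) (v j))
      else 0

/-- `L ⊗[𝓞 F] 𝓞 K` (with `Q` extended `𝓞 K`-quadratically) represents `α ∈ 𝓞 K`. -/
def RepresentsOver {F K : Type*} [Field F] [Field K] [Algebra F K] {L : Type*}
    [AddCommGroup L] [Module (𝓞 F) L] (Q : QuadraticMap (𝓞 F) L F) (α : 𝓞 K) : Prop :=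
  ∃ (n : ℕ) (c : Fin n → 𝓞 K) (v : Fin n → L), ExtVal Q c v = (α : K)

/-- `α ∈ 𝓞 K` is *`F`-representable*: some totally positive definite quadratic
`𝓞 F`-lattice represents `α` after base change to `𝓞 K`. -/
def FRepresentable (F : Type*) {K : Type*} [Field F] [Field K] [Algebra F K]
    (α : 𝓞 K) : Prop :=
  ∃ (L : Type) (_ : AddCommGroup L) (_ : Module (𝓞 F) L) (_ : Module.Finite (𝓞 F) L)
    (Q : QuadraticMap (𝓞 F) L F),
      IsTotallyPositiveDefinite Q ∧ RepresentsOver Q α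

/-- There exists a totally positive definite quadratic `𝓞 F`-lattice `L` such that
`L ⊗[𝓞 F] 𝓞 K` is universal over `𝓞 K`. -/
def ExistsUniversalLattice (F K : Type*) [Field F] [Field K] [Algebra F K] : Prop :=
  ∃ (L : Type) (_ : AddCommGroup L) (_ : Module (𝓞 F) L) (_ : Module.Finite (𝓞 F) L)
    (Q : QuadraticMap (𝓞 F) L F),
      IsTotallyPositiveDefinite Q ∧ ∀ α : 𝓞 K, TPos ((α : K)) → RepresentsOver Q α

/-- The relative discriminant ideal of a quadratic extension `K/F`: the ideal of `𝓞 F`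
generated by all `det (Tr_{K/F} (aᵢ * aⱼ))` with `a₁, a₂ ∈ 𝓞 K`. -/
def RelDiscr (F K : Type*) [Field F] [Field K] [Algebra F K] : Ideal (𝓞 F) :=
  Ideal.span {d : 𝓞 F | ∃ a₁ a₂ : 𝓞 K,
    (d : F) =
      Algebra.trace F K ((a₁ : K) * (a₁ : K)) * Algebra.trace F K ((a₂ : K) * (a₂ : K)) -
        Algebra.trace F K ((a₁ : K) * (a₂ : K)) * Algebra.trace F K ((a₂ : K) * (a₁ : K))}

/-- `α ∈ 𝓞 K` is *indecomposable* (as a totally positive integer) if it cannot be written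
as a sum of two totally positive elements of `𝓞 K`. -/
def Indecomposable' {K : Type*} [Field K] (α : 𝓞 K) : Prop :=
  ¬ ∃ β γ : 𝓞 K, TPos ((β : K)) ∧ TPos ((γ : K)) ∧ α = β + γ

section NT
open NumberField

variable {K : Type} [Field K]

lemma exists_realHom (hK : IsTotallyRealField K) (φ : K →+* ℂ) :
    ∃ σ : K →+* ℝ, ∀ x, φ x = (σ x : ℂ) := by
  have h : ∀ x, φ x = ((φ x).re : ℂ) := fun x => by
    apply Complex.ext <;> simp [hK φ x]
  refine ⟨{ toFun := fun x => (φ x).re, map_one' := by simp, map_zero' := by simp,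
            map_add' := by simp, map_mul' := fun x y => by simp [hK φ x] }, h⟩

variable [NumberField K]

lemma finite_bdd (hK : IsTotallyRealField K) (B : ℝ) :
    {x : 𝓞 K | TPos (x : K) ∧ ∀ σ : K →+* ℝ, σ x ≤ B}.Finite := by
  have := NumberField.Embeddings.finite_of_norm_le K ℂ B
  refine Set.Finite.of_finite_image (f := fun x : 𝓞 K => (x : K)) (this.subset ?_)
    (RingOfIntegers.coe_injective.injOn)
  rintro _ ⟨x, ⟨hx, hB⟩, rfl⟩
  refine ⟨x.2, fun φ => ?_⟩
  obtain ⟨σ, hσ⟩ := exists_realHom hK φ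
  rw [hσ, Complex.norm_real, Real.norm_of_nonneg (hx σ).le]
  exact hB σ

lemma finite_realHom : Finite (K →+* ℝ) :=
  Finite.of_injective (fun σ : K →+* ℝ => (Complex.ofRealHom.comp σ : K →+* ℂ)) (by
    intro σ τ h
    ext x
    have := congrArg (fun f : K →+* ℂ => f x) h
    simpa using this)

lemma nonempty_realHom (hK : IsTotallyRealField K) : Nonempty (K →+* ℝ) := by
  obtain ⟨φ⟩ : Nonempty (K →+* ℂ) := inferInstance
  exact ⟨(exists_realHom hK φ).choose⟩

/-- Any property closed under sums of totally positive elements and true for indecomposables. -/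
lemma indec_induction (hK : IsTotallyRealField K) (P : 𝓞 K → Prop)
    (hind : ∀ α : 𝓞 K, TPos (α : K) → Indecomposable' α → P α)
    (hadd : ∀ α β, P α → P β → P (α + β)) (α : 𝓞 K) (hα : TPos (α : K)) : P α := by
  let T : 𝓞 K → Set (𝓞 K) := fun α => {β | TPos (β : K) ∧ ∀ σ : K →+* ℝ, σ β ≤ σ α}
  have hfin : ∀ α, (T α).Finite := by
    intro α
    have := finite_realHom (K := K)
    obtain ⟨B, hB⟩ := (Set.finite_range (fun σ : K →+* ℝ => σ α)).bddAbove
    exact (finite_bdd hK B).subset fun β hβ => ⟨hβ.1, fun σ => (hβ.2 σ).trans (hB ⟨σ, rfl⟩)⟩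
  obtain ⟨σ₀⟩ := nonempty_realHom hK
  have key : ∀ β γ : 𝓞 K, TPos (β : K) → TPos (γ : K) → (T β).ncard < (T (β + γ)).ncard := by
    intro β γ hβ hγ
    refine Set.ncard_lt_ncard ⟨fun x hx => ⟨hx.1, fun σ => (hx.2 σ).trans ?_⟩, fun h => ?_⟩ (hfin _)
    · have := hγ σ
      simp only [map_add]; linarith
    · have h1 : β + γ ∈ T (β + γ) := ⟨fun σ => by
        have := hγ σ; have := hβ σ
        simp only [map_add]; linarith, fun σ => le_rfl⟩
      have h2 := (h h1).2 σ₀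
      have := hγ σ₀
      simp only [map_add] at h2; linarith
  induction hn : (T α).ncard using Nat.strong_induction_on generalizing α with
  | _ n ih =>
    by_cases hi : Indecomposable' α
    · exact hind α hα hi
    · obtain ⟨β, γ, hβ, hγ, rfl⟩ := not_not.mp hi
      refine hadd _ _ (ih _ (hn ▸ key β γ hβ hγ) β hβ rfl) (ih _ ?_ γ hγ rfl)
      rw [← hn, add_comm]; exact key γ β hγ hβ

open mixedEmbedding in
lemma unit_balance (hK : IsTotallyRealField K) :
    ∃ C : ℝ, 1 ≤ C ∧ ∀ α : 𝓞 K, TPos (α : K) → ∃ u : (𝓞 K)ˣ, ∀ σ τ : K →+* ℝ,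
      σ (((u : 𝓞 K) : K) ^ 2 * α) ≤ C * τ (((u : 𝓞 K) : K) ^ 2 * α) := by
  classical
  have hreal : ∀ w : InfinitePlace K, w.IsReal := by
    intro w
    rw [← w.mk_embedding, InfinitePlace.isReal_mk_iff]
    obtain ⟨σ, hσ⟩ := exists_realHom hK w.embedding
    ext x
    simp [hσ]
  obtain ⟨B0, hB0⟩ := (fundamentalCone.isBounded_normLeOne (K := K)).exists_norm_le
  set B := max B0 1 with hBdef
  have hB1 : 1 ≤ B := le_max_right _ _
  set n := Fintype.card (InfinitePlace K)
  refine ⟨(B * B ^ n) ^ 2, one_le_pow₀ (one_le_mul_of_one_le_of_one_le hB1 (one_le_pow₀ hB1)), ?_⟩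
  intro α hα
  have hα0 : (α : K) ≠ 0 := by
    obtain ⟨σ₀⟩ := nonempty_realHom hK
    intro h
    have := hα σ₀
    simp [h] at this
  have hwpos : ∀ w : InfinitePlace K, 0 < w (α : K) := fun w => InfinitePlace.pos_iff.mpr hα0
  let x : mixedSpace K := (fun w => √(w.1 (α : K)), fun w => ((√(w.1 (α : K)) : ℝ) : ℂ))
  have hx : ∀ w, normAtPlace w x = √(w (α : K)) := by
    intro w
    rw [normAtPlace_apply_of_isReal (hreal w)]
    simp [x, abs_of_nonneg (Real.sqrt_nonneg _)]
  have hxn : 0 < mixedEmbedding.norm x := by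
    refine lt_of_le_of_ne (mixedEmbedding.norm_nonneg x) (Ne.symm ?_)
    rw [mixedEmbedding.norm_ne_zero_iff]
    intro w; rw [hx]; exact (Real.sqrt_pos.mpr (hwpos w)).ne'
  set t : ℝ := (mixedEmbedding.norm x) ^ (-(1 / (Module.finrank ℚ K : ℝ))) with ht
  have htpos : 0 < t := Real.rpow_pos_of_pos hxn _
  have hd0 : (Module.finrank ℚ K : ℝ) ≠ 0 := by
    exact_mod_cast (Module.finrank_pos (R := ℚ) (M := K)).ne'
  have htx : mixedEmbedding.norm (t • x) = 1 := by
    rw [mixedEmbedding.norm_smul, abs_of_pos htpos, ht, ← Real.rpow_natCast, ← Real.rpow_mul hxn.le]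
    rw [neg_mul, one_div, inv_mul_cancel₀ hd0, Real.rpow_neg_one, inv_mul_cancel₀ hxn.ne']
  obtain ⟨u, hu⟩ := fundamentalCone.exists_unit_smul_mem (x := t • x) (by rw [htx]; norm_num)
  have hnorm : mixedEmbedding.norm (u • (t • x)) = 1 := by
    rw [norm_unit_smul, htx]
  have hmem : u • (t • x) ∈ fundamentalCone.normLeOne K := ⟨hu, hnorm.le⟩
  have hle := hB0 _ hmem
  have hyv : ∀ w, normAtPlace w (u • (t • x)) = w ((u : 𝓞 K) : K) * (t * √(w (α : K))) := by
    intro w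
    rw [unitSMul_smul, map_mul, normAtPlace_apply, normAtPlace_smul, abs_of_pos htpos, hx]
  have hupos : ∀ w : InfinitePlace K, 0 < w ((u : 𝓞 K) : K) := fun w => by
    rw [InfinitePlace.pos_iff]
    simp
  set y : InfinitePlace K → ℝ := fun w => w ((u : 𝓞 K) : K) * (t * √(w (α : K))) with hy
  have hypos : ∀ w, 0 < y w := fun w =>
    mul_pos (hupos w) (mul_pos htpos (Real.sqrt_pos.mpr (hwpos w)))
  have hyB : ∀ w, y w ≤ B := by
    intro w
    rw [hy]; simp only; rw [← hyv]
    refine le_trans ?_ (hle.trans (le_max_left _ _))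
    rw [norm_eq_sup'_normAtPlace]
    exact Finset.le_sup' (fun w => normAtPlace w (u • t • x)) (Finset.mem_univ w)
  have hprod : ∏ w, y w = 1 := by
    rw [← hnorm, mixedEmbedding.norm_apply]
    refine Finset.prod_congr rfl fun w _ => ?_
    rw [hyv]
    rw [show w.mult = 1 from if_pos (hreal w), pow_one]
  have hylow : ∀ w, 1 ≤ y w * B ^ n := by
    intro w
    rw [← hprod, ← Finset.mul_prod_erase _ _ (Finset.mem_univ w)]
    refine mul_le_mul_of_nonneg_left ?_ (hypos w).le
    calc ∏ v ∈ Finset.univ.erase w, y v ≤ ∏ v ∈ Finset.univ.erase w, B :=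
          Finset.prod_le_prod (fun v _ => (hypos v).le) (fun v _ => hyB v)
      _ = B ^ (Finset.univ.erase w).card := by simp
      _ ≤ B ^ n := pow_le_pow_right₀ hB1 (Finset.card_le_univ _)
  have hyy : ∀ v w, y v ≤ (B * B ^ n) * y w := by
    intro v w
    have := hylow w
    have h2 := hyB v
    nlinarith
  have hysq : ∀ w : InfinitePlace K, y w ^ 2 = t ^ 2 * w (((u : 𝓞 K) : K) ^ 2 * α) := by
    intro w
    rw [hy]; simp only [mul_pow, map_mul, map_pow, Real.sq_sqrt (hwpos w).le]; ring
  have hplace : ∀ σ : K →+* ℝ, ∃ w : InfinitePlace K,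
      w (((u : 𝓞 K) : K) ^ 2 * α) = σ (((u : 𝓞 K) : K) ^ 2 * α) := by
    intro σ
    refine ⟨InfinitePlace.mk (Complex.ofRealHom.comp σ), ?_⟩
    rw [InfinitePlace.apply]
    simp [abs_of_pos (hα σ)]
  refine ⟨u, fun σ τ => ?_⟩
  obtain ⟨v, hv⟩ := hplace σ
  obtain ⟨w, hw⟩ := hplace τ
  rw [← hv, ← hw]
  have h1 : y v ^ 2 ≤ ((B * B ^ n) * y w) ^ 2 := pow_le_pow_left₀ (hypos v).le (hyy v w) 2
  rw [mul_pow (B * B ^ n), hysq, hysq] at h1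
  have ht2 : 0 < t ^ 2 := by positivity
  refine le_of_mul_le_mul_left ?_ ht2
  linarith

/-- Balanced elements are sums of elements of a fixed bounded set. -/
lemma balanced_sum (C : ℝ) (hK : IsTotallyRealField K) :
    ∃ R : ℝ, ∀ α : 𝓞 K, TPos (α : K) → (∀ σ τ : K →+* ℝ, σ α ≤ C * τ α) →
      α ∈ AddSubmonoid.closure {x : 𝓞 K | TPos (x : K) ∧ ∀ σ : K →+* ℝ, σ x ≤ R} := by
  classical
  have := finite_realHom (K := K)
  have := Fintype.ofFinite (K →+* ℝ)
  have := nonempty_realHom hK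
  let b := RingOfIntegers.basis K
  obtain ⟨D0, hD0⟩ := (Set.finite_range (fun σ : K →+* ℝ => ∑ i, |σ (b i)|)).bddAbove
  set D := max D0 1
  have hD : ∀ σ : K →+* ℝ, ∑ i, |σ (b i)| ≤ D := fun σ => (hD0 ⟨σ, rfl⟩).trans (le_max_left _ _)
  have hD1 : 1 ≤ D := le_max_right _ _
  refine ⟨2 * |C| * D + D, fun α hα hC => ?_⟩
  obtain ⟨τ, hτ⟩ := Finite.exists_min (fun σ : K →+* ℝ => σ α)
  have hC' : ∀ σ : K →+* ℝ, σ α ≤ |C| * τ α := fun σ =>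
    (hC σ τ).trans (mul_le_mul_of_nonneg_right (le_abs_self C) (hα τ).le)
  obtain ⟨m, hm1, hm2⟩ : ∃ m : ℕ, (m : ℝ) * D < τ α ∧ τ α ≤ (m + 1) * D := by
    have hDp : 0 < D := by linarith
    have hpos : 0 < τ α / D := div_pos (hα τ) hDp
    have hc : 0 < ⌈τ α / D⌉₊ := Nat.ceil_pos.mpr hpos
    refine ⟨⌈τ α / D⌉₊ - 1, ?_, ?_⟩
    · rw [← lt_div_iff₀ hDp]
      exact Nat.lt_ceil.mp (by omega)
    · rw [← div_le_iff₀ hDp]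
      have : ((⌈τ α / D⌉₊ - 1 : ℕ) : ℝ) + 1 = (⌈τ α / D⌉₊ : ℝ) := by
        exact_mod_cast Nat.sub_add_cancel hc
      rw [this]; exact Nat.le_ceil _
  rcases Nat.eq_zero_or_pos m with rfl | hmpos
  · refine AddSubmonoid.subset_closure ⟨hα, fun σ => (hC' σ).trans ?_⟩
    have : |C| * τ α ≤ |C| * D := mul_le_mul_of_nonneg_left (by simpa using hm2) (abs_nonneg C)
    nlinarith [abs_nonneg C, mul_nonneg (abs_nonneg C) (by linarith : (0:ℝ) ≤ D)]
  · let a := fun i => b.repr α i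
    let β : ℕ → 𝓞 K := fun k => ∑ i, (a i / (m : ℤ) + if (k : ℤ) < a i % m then 1 else 0) • b i
    have hm0 : (m : ℤ) ≠ 0 := by exact_mod_cast hmpos.ne'
    have hsum : α = ∑ k ∈ Finset.range m, β k := by
      simp only [β]
      rw [Finset.sum_comm]
      conv_lhs => rw [← b.sum_repr α]
      refine Finset.sum_congr rfl fun i _ => ?_
      rw [← Finset.sum_smul]
      congr 1
      rw [Finset.sum_add_distrib, Finset.sum_const, Finset.card_range, ← Finset.sum_filter,
        Finset.sum_const]
      have h1 := Int.emod_nonneg (a i) hm0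
      have h2 := Int.emod_lt_of_pos (a i) (by exact_mod_cast hmpos : (0:ℤ) < m)
      have : (Finset.range m).filter (fun k : ℕ => (k : ℤ) < a i % m)
          = Finset.range (a i % m).toNat := by
        ext k; simp only [Finset.mem_filter, Finset.mem_range]; omega
      rw [this, Finset.card_range]
      have h3 := Int.mul_ediv_add_emod (a i) m
      simp only [nsmul_eq_mul, mul_one]
      rw [Int.toNat_of_nonneg h1]
      exact h3.symm
    have hmR : (0 : ℝ) < m := by exact_mod_cast hmpos
    have hdev : ∀ k, ∀ σ : K →+* ℝ, |σ (β k) - σ α / m| ≤ D := by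
      intro k σ
      refine le_trans ?_ (hD σ)
      have e1 : σ (α : K) = ∑ i, (a i : ℝ) * σ (b i) := by
        conv_lhs => rw [← b.sum_repr α]
        simp [a]
      have e2 : σ (β k : K) = ∑ i, (((a i / (m : ℤ) + if (k : ℤ) < a i % m then 1 else 0) : ℤ) : ℝ)
          * σ (b i) := by
        simp [β]
      rw [e1, e2, Finset.sum_div, ← Finset.sum_sub_distrib]
      refine (Finset.abs_sum_le_sum_abs _ _).trans (Finset.sum_le_sum fun i _ => ?_)
      have h1 := Int.emod_nonneg (a i) hm0
      have h2 := Int.emod_lt_of_pos (a i) (by exact_mod_cast hmpos : (0:ℤ) < m)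
      have h3 := Int.mul_ediv_add_emod (a i) m
      have h1' : (0:ℝ) ≤ ((a i % m : ℤ) : ℝ) := by exact_mod_cast h1
      have h2' : ((a i % m : ℤ) : ℝ) < m := by exact_mod_cast h2
      have h3' : (m : ℝ) * ((a i / m : ℤ) : ℝ) + ((a i % m : ℤ) : ℝ) = a i := by exact_mod_cast h3
      have : (((a i / (m : ℤ) + if (k : ℤ) < a i % m then 1 else 0) : ℤ) : ℝ) * σ (b i)
          - (a i : ℝ) * σ (b i) / m =
          ((if (k : ℤ) < a i % m then 1 else 0) - ((a i % m : ℤ) : ℝ) / m) * σ (b i) := by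
        rw [← h3']
        push_cast
        field_simp
        ring
      rw [this, abs_mul]
      refine mul_le_of_le_one_left (abs_nonneg _) ?_
      have h4 : 0 ≤ ((a i % m : ℤ) : ℝ) / m := by positivity
      have h5 : ((a i % m : ℤ) : ℝ) / m ≤ 1 := (div_le_one hmR).mpr h2'.le
      rw [abs_le]
      split_ifs <;> constructor <;> linarith
    rw [hsum]
    refine AddSubmonoid.sum_mem _ fun k _ => AddSubmonoid.subset_closure ⟨fun σ => ?_, fun σ => ?_⟩
    · have h1 := (abs_le.mp (hdev k σ)).1
      have h2 : D < σ α / m := by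
        rw [lt_div_iff₀ hmR]
        have := hτ σ
        linarith
      linarith
    · have h1 := (abs_le.mp (hdev k σ)).2
      have h2 : σ α / m ≤ 2 * |C| * D := by
        rw [div_le_iff₀ hmR]
        refine (hC' σ).trans ?_
        have hm1' : (1 : ℝ) ≤ m := by exact_mod_cast hmpos
        have : τ α ≤ 2 * m * D := hm2.trans (by nlinarith)
        calc |C| * τ α ≤ |C| * (2 * m * D) := mul_le_mul_of_nonneg_left this (abs_nonneg C)
          _ = _ := by ring
      linarith

end NT
section QF

variable {F K : Type} [Field F] [Field K] [Algebra F K]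

lemma two_mul_extVal {L : Type} [AddCommGroup L] [Module (𝓞 F) L] (Q : QuadraticMap (𝓞 F) L F)
    {n : ℕ} (c : Fin n → 𝓞 K) (v : Fin n → L) :
    2 * ExtVal Q c v = ∑ i, ∑ j, (c i : K) * (c j : K) *
      algebraMap F K (QuadraticMap.polar (⇑Q) (v i) (v j)) := by
  set f : Fin n → Fin n → K := fun i j => (c i : K) * (c j : K) *
      algebraMap F K (QuadraticMap.polar (⇑Q) (v i) (v j)) with hf
  have hsymm : ∀ i j, f i j = f j i := fun i j => by
    simp only [hf]; rw [QuadraticMap.polar_comm, mul_comm (c i : K)]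
  have hdiag : ∀ i, f i i = 2 * ((c i : K) ^ 2 * algebraMap F K (Q (v i))) := fun i => by
    simp only [hf]; rw [QuadraticMap.polar_self, two_smul, map_add]; ring
  have hsplit : ∀ i j, f i j = (if i = j then f i i else 0) + (if i < j then f i j else 0)
      + (if j < i then f j i else 0) := by
    intro i j
    rcases lt_trichotomy i j with h | h | h
    · simp [h, h.ne, h.not_gt]
    · subst h; simp
    · simp [h, h.ne', h.not_gt, hsymm i j]
  have e : ∑ i, ∑ j, f i j = ∑ i, f i i + ∑ i, ∑ j, (if i < j then f i j else 0)
      + ∑ i, ∑ j, (if j < i then f j i else 0) := by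
    rw [Finset.sum_congr rfl fun i _ => Finset.sum_congr rfl fun j _ => hsplit i j]
    simp [Finset.sum_add_distrib]
  rw [e, Finset.sum_comm (f := fun i j => if j < i then f j i else 0)]
  simp only [hdiag, ← Finset.mul_sum, ExtVal]
  simp only [hf]
  ring

lemma representsOver_iff [CharZero K] {L : Type} [AddCommGroup L] [Module (𝓞 F) L]
    (Q : QuadraticMap (𝓞 F) L F) (α : 𝓞 K) :
    RepresentsOver Q α ↔ ∃ (ι : Type) (_ : Fintype ι) (c : ι → 𝓞 K) (v : ι → L),
      ∑ i, ∑ j, (c i : K) * (c j : K) *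
        algebraMap F K (QuadraticMap.polar (⇑Q) (v i) (v j)) = 2 * (α : K) := by
  constructor
  · rintro ⟨n, c, v, h⟩
    exact ⟨Fin n, inferInstance, c, v, by rw [← two_mul_extVal, h]⟩
  · rintro ⟨ι, _, c, v, h⟩
    let e := (Fintype.equivFin ι).symm
    refine ⟨Fintype.card ι, c ∘ e, v ∘ e, ?_⟩
    apply mul_left_cancel₀ (two_ne_zero (α := K))
    rw [two_mul_extVal, ← h]
    rw [← e.sum_comp]
    refine Finset.sum_congr rfl fun i _ => ?_
    rw [← e.sum_comp]
    rfl

lemma RepresentsOver.sq_mul [CharZero K] {L : Type} [AddCommGroup L] [Module (𝓞 F) L]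
    {Q : QuadraticMap (𝓞 F) L F} {α : 𝓞 K} (h : RepresentsOver Q α) (e : 𝓞 K) :
    RepresentsOver Q (e ^ 2 * α) := by
  rw [representsOver_iff] at h ⊢
  obtain ⟨ι, _, c, v, h⟩ := h
  refine ⟨ι, inferInstance, fun i => e * c i, v, ?_⟩
  have : 2 * ((e ^ 2 * α : 𝓞 K) : K) = (e : K) ^ 2 * (2 * (α : K)) := by simp; ring
  rw [this, ← h, Finset.mul_sum]
  refine Finset.sum_congr rfl fun i _ => ?_
  rw [Finset.mul_sum]
  refine Finset.sum_congr rfl fun j _ => ?_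
  simp; ring

lemma polar_pi {ι : Type} [Fintype ι] {L : ι → Type} [∀ i, AddCommGroup (L i)]
    [∀ i, Module (𝓞 F) (L i)] (Q : ∀ i, QuadraticMap (𝓞 F) (L i) F) (x y : ∀ i, L i) :
    QuadraticMap.polar (⇑(QuadraticMap.pi Q)) x y =
      ∑ i, QuadraticMap.polar (⇑(Q i)) (x i) (y i) := by
  simp [QuadraticMap.polar, Finset.sum_sub_distrib]

lemma pi_represents [CharZero K] {ι : Type} [Fintype ι] {L : ι → Type} [∀ i, AddCommGroup (L i)]
    [∀ i, Module (𝓞 F) (L i)] (Q : ∀ i, QuadraticMap (𝓞 F) (L i) F) (α : ι → 𝓞 K)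
    (h : ∀ i, RepresentsOver (Q i) (α i)) : RepresentsOver (QuadraticMap.pi Q) (∑ i, α i) := by
  classical
  simp only [representsOver_iff] at h
  choose κ hκ c v h using h
  rw [representsOver_iff]
  refine ⟨Σ i, κ i, inferInstance, fun p => c p.1 p.2, fun p => Pi.single p.1 (v p.1 p.2), ?_⟩
  have key : ∀ (i j : ι) (x : L i) (y : L j),
      QuadraticMap.polar (⇑(QuadraticMap.pi Q)) (Pi.single i x) (Pi.single j y) =
      if hij : i = j then QuadraticMap.polar (⇑(Q j)) (hij ▸ x) y else 0 := by
    intro i j x y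
    rw [polar_pi]
    split_ifs with hij
    · subst hij
      rw [Finset.sum_eq_single i]
      · simp
      · intro k _ hk
        simp [Pi.single_eq_of_ne hk]
      · simp
    · refine Finset.sum_eq_zero fun k _ => ?_
      by_cases hk : k = i
      · subst hk
        simp [Pi.single_eq_of_ne hij]
      · simp [Pi.single_eq_of_ne hk]
  simp only [key, Fintype.sum_sigma]
  rw [show ((∑ i, α i : 𝓞 K) : K) = ∑ i, (α i : K) from map_sum (algebraMap (𝓞 K) K) _ _,
    Finset.mul_sum]
  refine Finset.sum_congr rfl fun i _ => ?_
  rw [← h i]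
  refine Finset.sum_congr rfl fun k _ => ?_
  rw [Finset.sum_eq_single i]
  · simp
  · intro j _ hj
    simp [hj.symm]
  · simp

lemma pi_tpd {ι : Type} [Fintype ι] {L : ι → Type} [∀ i, AddCommGroup (L i)]
    [∀ i, Module (𝓞 F) (L i)] (Q : ∀ i, QuadraticMap (𝓞 F) (L i) F)
    (h : ∀ i, IsTotallyPositiveDefinite (Q i)) :
    IsTotallyPositiveDefinite (QuadraticMap.pi Q) := by
  intro v hv σ
  obtain ⟨i, hi⟩ := Function.ne_iff.mp hv
  rw [QuadraticMap.pi_apply, map_sum]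
  refine Finset.sum_pos' (fun j _ => ?_) ⟨i, Finset.mem_univ i, h i _ hi σ⟩
  by_cases hj : v j = 0
  · simp [hj]
  · exact (h j _ hj σ).le

lemma frep_sum [CharZero K] {ι : Type} [Fintype ι] (α : ι → 𝓞 K)
    (h : ∀ i, FRepresentable F (α i)) : FRepresentable F (∑ i, α i) := by
  choose L i1 i2 i3 Q hQ hr using h
  exact ⟨∀ i, L i, inferInstance, inferInstance, inferInstance, QuadraticMap.pi Q,
    pi_tpd Q hQ, pi_represents Q α hr⟩

lemma frep_add [CharZero K] {α β : 𝓞 K} (ha : FRepresentable F α) (hb : FRepresentable F β) :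
    FRepresentable F (α + β) := by
  have := frep_sum (F := F) (fun b : Bool => if b then α else β) (by
    rintro (_ | _) <;> simpa)
  simpa using this

end QF

lemma universal_of_all (F K : Type) [Field F] [Field K] [NumberField K]
    [Algebra F K] (hK : IsTotallyRealField K)
    (h : ∀ α : 𝓞 K, TPos ((α : K)) → FRepresentable F α) : ExistsUniversalLattice F K := by
  classical
  obtain ⟨C, -, hC⟩ := unit_balance hK
  obtain ⟨R, hR⟩ := balanced_sum C hK
  set S : Set (𝓞 K) := {x : 𝓞 K | TPos (x : K) ∧ ∀ σ : K →+* ℝ, σ x ≤ R} with hS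
  have hfin : S.Finite := finite_bdd hK R
  have : Fintype S := hfin.fintype
  have hrep : ∀ s : S, FRepresentable F (s : 𝓞 K) := fun s => h s s.2.1
  choose L i1 i2 i3 Q hQ hr using hrep
  refine ⟨∀ p : S × Fin 4, L p.1, inferInstance, inferInstance, inferInstance,
    QuadraticMap.pi (fun p : S × Fin 4 => Q p.1), pi_tpd _ fun p => hQ p.1, fun α hα => ?_⟩
  obtain ⟨u, hu⟩ := hC α hα
  have hmem := hR ((u : 𝓞 K) ^ 2 * α) (fun σ => by
    have h1 := hα σ
    have h2 : σ ((u : 𝓞 K) : K) ≠ 0 := by simp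
    simp only [map_mul, map_pow]
    positivity) (by simpa using hu)
  have hmem' : (u : 𝓞 K) ^ 2 * α ∈ AddSubmonoid.closure (Set.range (fun s : S => (s : 𝓞 K))) := by
    rw [Subtype.range_coe]; exact hmem
  obtain ⟨n, hn⟩ := AddSubmonoid.mem_closure_range_iff_of_fintype.mp hmem'
  have h4 : ∀ s, ∃ a : Fin 4 → ℕ, ∑ i, a i ^ 2 = n s := fun s => by
    obtain ⟨a, b, c, d, e⟩ := Nat.sum_four_squares (n s)
    exact ⟨![a, b, c, d], by simp [Fin.sum_univ_four, e]⟩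
  choose a ha using h4
  have hfinal := pi_represents (K := K) (fun p : S × Fin 4 => Q p.1)
    (fun p => (((u⁻¹ : (𝓞 K)ˣ) : 𝓞 K) * (a p.1 p.2 : 𝓞 K)) ^ 2 * (p.1 : 𝓞 K))
    (fun p => (hr p.1).sq_mul _)
  convert hfinal using 1
  rw [Fintype.sum_prod_type]
  have hα' : α = ((u⁻¹ : (𝓞 K)ˣ) : 𝓞 K) ^ 2 * ((u : 𝓞 K) ^ 2 * α) := by
    rw [← mul_assoc, ← mul_pow, Units.inv_mul, one_pow, one_mul]
  rw [hα', hn, Finset.mul_sum]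
  refine Finset.sum_congr rfl fun s _ => ?_
  rw [← ha s]
  simp only [nsmul_eq_mul, Nat.cast_sum, Nat.cast_pow, Finset.sum_mul, Finset.mul_sum]
  refine Finset.sum_congr rfl fun i _ => ?_
  ring

/-- The following are equivalent: (1) there exists a totally positive
definite quadratic `𝓞 F`-lattice whose base change to `𝓞 K` is universal;
(2) every totally positive element of `𝓞 K` is `F`-representable;
(3) every indecomposable totally positive element of `𝓞 K` is `F`-representable. -/
theorem statement2 (F K : Type) [Field F] [NumberField F] [Field K] [NumberField K]
    [Algebra F K] (hF : IsTotallyRealField F) (hK : IsTotallyRealField K)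
    (d : ℕ) (hd : Module.finrank F K = d) :
    (ExistsUniversalLattice F K ↔ ∀ α : 𝓞 K, TPos ((α : K)) → FRepresentable F α) ∧
    (ExistsUniversalLattice F K ↔
      ∀ α : 𝓞 K, TPos ((α : K)) → Indecomposable' α → FRepresentable F α) := by
  have h12 : ExistsUniversalLattice F K → ∀ α : 𝓞 K, TPos ((α : K)) → FRepresentable F α := by
    rintro ⟨L, i1, i2, i3, Q, hQ, hr⟩ α hα
    exact ⟨L, i1, i2, i3, Q, hQ, hr α hα⟩
  refine ⟨⟨h12, universal_of_all F K hK⟩, ⟨fun h α hα _ => h12 h α hα, fun h => ?_⟩⟩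
  exact universal_of_all F K hK
    (indec_induction hK (FRepresentable F) h fun _ _ ha hb => frep_add ha hb)

end
end

section
/- Let F1, F2 be number fields of degrees n1, n2 over ℚ respectively, with gcd(Disc(F1), Disc(F2)) = 1, and suppose the compositum F1F2 has degree n1·n2 over ℚ. Then Disc(F1F2) = Disc(F1)^{n2} · Disc(F2)^{n1}, and the ring of integers of F1F2 equals O_{F1}·O_{F2} (the subring generated by O_{F1} and O_{F2}). -/
open scoped NumberField TensorProduct
open Finset

noncomputable section

/-- The absolute discriminant of a field, defined to be the discriminant when the field is
a number field and `0` otherwise. -/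
noncomputable def absDiscr (F : Type*) [Field F] : ℤ :=
  @dite _ (NumberField F) (Classical.dec _) (fun h => @NumberField.discr F _ h) (fun _ => 0)

section Helpers
open NumberField IntermediateField Module

theorem aux_trace {L : Type*} [Field L] [NumberField L] (F₁ F₂ : IntermediateField ℚ L)
    (h₁ : F₁.LinearDisjoint F₂) (h₂ : F₁ ⊔ F₂ = ⊤) (x : 𝓞 F₁) (y : 𝓞 F₂) :
    Algebra.trace ℤ (𝓞 L) (algebraMap (𝓞 F₁) (𝓞 L) x * algebraMap (𝓞 F₂) (𝓞 L) y) =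
      Algebra.trace ℤ (𝓞 F₁) x * Algebra.trace ℤ (𝓞 F₂) y := by
  have key : ∀ (K : Type _) [Field K] [NumberField K] (z : 𝓞 K),
      ((Algebra.trace ℤ (𝓞 K) z : ℤ) : ℚ) = Algebra.trace ℚ K (z : K) := by
    intro K _ _ z
    exact (Algebra.trace_localization ℤ (nonZeroDivisors ℤ) (Rₘ := ℚ) (Sₘ := K) z).symm
  have e : ((algebraMap (𝓞 F₁) (𝓞 L) x * algebraMap (𝓞 F₂) (𝓞 L) y : 𝓞 L) : L) =
    (x : F₁) • algebraMap F₂ L (y : F₂) := by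
    rw [Algebra.smul_def]; rfl
  rw [← Int.cast_inj (α := ℚ), Int.cast_mul, key, key, key, e,
    ← Algebra.trace_trace (S := F₁), map_smul, h₁.trace_algebraMap h₂, smul_eq_mul, mul_comm,
    ← Algebra.smul_def, map_smul, smul_eq_mul, mul_comm]
  rfl

theorem aux_discr {L : Type*} [Field L] [NumberField L] (F₁ F₂ : IntermediateField ℚ L)
    (h₁ : F₁.LinearDisjoint F₂) (h₂ : F₁ ⊔ F₂ = ⊤) 
    (h₃ : IsCoprime (discr F₁) (discr F₂)) :
    discr L = discr F₁ ^ Module.finrank ℚ F₂ * discr F₂ ^ Module.finrank ℚ F₁ := by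
  classical
  have h₂' : F₁.toSubalgebra ⊔ F₂.toSubalgebra = ⊤ := by
    simp [← sup_toSubalgebra_of_left, h₂]
  let b₁ := RingOfIntegers.basis F₁
  let b₂ := RingOfIntegers.basis F₂
  let B := b₂.ofIsCoprimeDifferentIdeal ℤ (𝓞 L) (𝓞 F₁) (𝓞 F₂) h₁ h₂'
    (isCoprime_differentIdeal_of_isCoprime_discr _ h₃)
  have hB : ∀ j, B j = algebraMap (𝓞 F₂) (𝓞 L) (b₂ j) := fun j =>
    Module.Basis.ofIsCoprimeDifferentIdeal_apply ℤ (𝓞 L) (𝓞 F₁) (𝓞 F₂) h₁ h₂' _ b₂ j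
  let C := b₁.smulTower B
  have hC : Algebra.traceMatrix ℤ C = Matrix.kroneckerMap (· * ·)
    (Algebra.traceMatrix ℤ b₁) (Algebra.traceMatrix ℤ b₂) := by
    ext ⟨i, j⟩ ⟨k, l⟩
    simp only [Algebra.traceMatrix_apply, Algebra.traceForm_apply, Matrix.kroneckerMap_apply]
    rw [← aux_trace F₁ F₂ h₁ h₂]
    congr 1
    simp only [C, Basis.smulTower_apply, hB,
      Algebra.smul_def, map_mul]
    ring
  rw [← discr_eq_discr L C, Algebra.discr_def, hC, Matrix.det_kronecker, ← Algebra.discr_def,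
    ← Algebra.discr_def, discr_eq_discr, discr_eq_discr, ← Module.finrank_eq_card_basis b₁,
    ← Module.finrank_eq_card_basis b₂, RingOfIntegers.rank, RingOfIntegers.rank]

theorem aux_ring {L : Type*} [Field L] [NumberField L] (F₁ F₂ : IntermediateField ℚ L)
    (h₁ : F₁.LinearDisjoint F₂) (h₂ : F₁ ⊔ F₂ = ⊤) 
    (h₃ : IsCoprime (discr F₁) (discr F₂)) :
    Subring.closure ({x : L | x ∈ F₁ ∧ IsIntegral ℤ x} ∪ {x : L | x ∈ F₂ ∧ IsIntegral ℤ x}) =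
     (integralClosure ℤ L).toSubring := by
  have h₂' : F₁.toSubalgebra ⊔ F₂.toSubalgebra = ⊤ := by
    simp [← sup_toSubalgebra_of_left, h₂]
  let b₂ := RingOfIntegers.basis F₂
  let B := b₂.ofIsCoprimeDifferentIdeal ℤ (𝓞 L) (𝓞 F₁) (𝓞 F₂) h₁ h₂'
    (isCoprime_differentIdeal_of_isCoprime_discr _ h₃)
  have hB : ∀ j, B j = algebraMap (𝓞 F₂) (𝓞 L) (b₂ j) := fun j =>
    Module.Basis.ofIsCoprimeDifferentIdeal_apply ℤ (𝓞 L) (𝓞 F₁) (𝓞 F₂) h₁ h₂' _ b₂ j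
  apply le_antisymm
  · rw [Subring.closure_le]
    rintro x (hx | hx)
    · exact hx.2
    · exact hx.2
  · intro x hx
    have := congrArg (algebraMap (𝓞 L) L) (B.sum_repr ⟨x, hx⟩)
    change _ = x at this
    rw [← this, map_sum]
    refine sum_mem fun i _ => ?_
    rw [Algebra.smul_def, map_mul]
    refine mul_mem (Subring.subset_closure (Or.inl ⟨?_, RingOfIntegers.isIntegral_coe _⟩))
      (Subring.subset_closure (Or.inr ⟨?_, RingOfIntegers.isIntegral_coe _⟩))
    · exact ((B.repr ⟨x, hx⟩ i : 𝓞 F₁) : F₁).2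
    · rw [hB]
      exact ((b₂ i : 𝓞 F₂) : F₂).2

theorem aux_both {L : Type*} [Field L] [NumberField L] [i : Algebra ℚ L]
    (F₁ F₂ : IntermediateField ℚ L)
    (h₁ : F₁.LinearDisjoint F₂) (h₂ : F₁ ⊔ F₂ = ⊤)
    (h₃ : IsCoprime (discr F₁) (discr F₂)) (n₁ n₂ : ℕ)
    (hn₁ : finrank ℚ F₁ = n₁) (hn₂ : finrank ℚ F₂ = n₂) :
    discr L = discr F₁ ^ n₂ * discr F₂ ^ n₁ ∧
    Subring.closure ({x : L | x ∈ F₁ ∧ IsIntegral ℤ x} ∪ {x : L | x ∈ F₂ ∧ IsIntegral ℤ x}) =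
     (integralClosure ℤ L).toSubring := by
  obtain rfl : i = DivisionRing.toRatAlgebra := Subsingleton.elim _ _
  refine ⟨?_, aux_ring F₁ F₂ h₁ h₂ h₃⟩
  rw [← hn₁, ← hn₂]
  exact aux_discr F₁ F₂ h₁ h₂ h₃

theorem statement10_aux (F₁ F₂ : IntermediateField ℚ (AlgebraicClosure ℚ))
    [NumberField F₁] [NumberField F₂] (n₁ n₂ : ℕ)
    (hn₁ : Module.finrank ℚ F₁ = n₁) (hn₂ : Module.finrank ℚ F₂ = n₂)
    (hgcd : Int.gcd (NumberField.discr F₁) (NumberField.discr F₂) = 1)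
    (hdeg : Module.finrank ℚ ↥(F₁ ⊔ F₂) = n₁ * n₂) :
    absDiscr ↥(F₁ ⊔ F₂) = NumberField.discr F₁ ^ n₂ * NumberField.discr F₂ ^ n₁ ∧
    Subring.closure
        ((IntermediateField.inclusion (le_sup_left : F₁ ≤ F₁ ⊔ F₂)) ''
            {x : F₁ | IsIntegral ℤ x} ∪
          (IntermediateField.inclusion (le_sup_right : F₂ ≤ F₁ ⊔ F₂)) ''
            {x : F₂ | IsIntegral ℤ x}) =
      (integralClosure ℤ ↥(F₁ ⊔ F₂)).toSubring := by
  have : FiniteDimensional ℚ ↥(F₁ ⊔ F₂) := IntermediateField.finiteDimensional_sup F₁ F₂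
  have : NumberField ↥(F₁ ⊔ F₂) := NumberField.of_module_finite ℚ _
  let G₁ := IntermediateField.restrict (le_sup_left : F₁ ≤ F₁ ⊔ F₂)
  let G₂ := IntermediateField.restrict (le_sup_right : F₂ ≤ F₁ ⊔ F₂)
  let e₁ : F₁ ≃ₐ[ℚ] G₁ := IntermediateField.restrictAlgEquiv _
  let e₂ : F₂ ≃ₐ[ℚ] G₂ := IntermediateField.restrictAlgEquiv _
  have htop : G₁ ⊔ G₂ = ⊤ := by
    apply IntermediateField.lift_injective
    rw [IntermediateField.lift_sup, IntermediateField.lift_restrict, 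
      IntermediateField.lift_restrict, IntermediateField.lift_top]
  have hd1 : discr F₁ = discr G₁ := discr_eq_discr_of_algEquiv _ e₁
  have hd2 : discr F₂ = discr G₂ := discr_eq_discr_of_algEquiv _ e₂
  have hf1 : finrank ℚ G₁ = n₁ := e₁.toLinearEquiv.finrank_eq.symm.trans hn₁
  have hf2 : finrank ℚ G₂ = n₂ := e₂.toLinearEquiv.finrank_eq.symm.trans hn₂
  have hdis : G₁.LinearDisjoint G₂ := by
    apply IntermediateField.LinearDisjoint.of_finrank_sup
    rw [htop, IntermediateField.finrank_top', hdeg, hf1, hf2]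
  have hc : IsCoprime (discr G₁) (discr G₂) := by
    rw [← hd1, ← hd2]; exact Int.isCoprime_iff_gcd_eq_one.mpr hgcd
  obtain ⟨hA, hR⟩ := aux_both G₁ G₂ hdis htop hc n₁ n₂ hf1 hf2
  constructor
  · rw [absDiscr, dif_pos this, hd1, hd2]
    exact hA
  · refine Eq.trans ?_ hR
    have im : ∀ (F E : IntermediateField ℚ (AlgebraicClosure ℚ)) (h : F ≤ E),
        IntermediateField.inclusion h '' {x : F | IsIntegral ℤ x} =
        {x : E | x ∈ IntermediateField.restrict h ∧ IsIntegral ℤ x} := by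
      intro F E h
      ext x
      constructor
      · rintro ⟨y, hy, rfl⟩
        exact ⟨(IntermediateField.mem_restrict h _).2 y.2, 
          IsIntegral.map ((IntermediateField.inclusion h).restrictScalars ℤ) hy⟩
      · rintro ⟨hx, hi⟩
        refine ⟨⟨x.1, (IntermediateField.mem_restrict h _).1 hx⟩, ?_, rfl⟩
        exact (isIntegral_algHom_iff ((IntermediateField.inclusion h).restrictScalars ℤ)
          (IntermediateField.inclusion h).injective).1 hi
    rw [im, im]
    rfl

end Helpers

/-- Let `F₁, F₂` be number fields of degrees `n₁, n₂` with coprime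
discriminants whose compositum `F₁F₂` has degree `n₁ n₂`.  Then
`Disc(F₁F₂) = Disc(F₁)^{n₂} · Disc(F₂)^{n₁}` and the ring of integers of `F₁F₂` is the
subring generated by (the images of) `𝓞 F₁` and `𝓞 F₂`. -/
theorem statement10 (F₁ F₂ : IntermediateField ℚ (AlgebraicClosure ℚ))
    [NumberField F₁] [NumberField F₂] (n₁ n₂ : ℕ)
    (hn₁ : Module.finrank ℚ F₁ = n₁) (hn₂ : Module.finrank ℚ F₂ = n₂)
    (hgcd : Int.gcd (NumberField.discr F₁) (NumberField.discr F₂) = 1)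
    (hdeg : Module.finrank ℚ ↥(F₁ ⊔ F₂) = n₁ * n₂) :
    absDiscr ↥(F₁ ⊔ F₂) = NumberField.discr F₁ ^ n₂ * NumberField.discr F₂ ^ n₁ ∧
    Subring.closure
        ((IntermediateField.inclusion (le_sup_left : F₁ ≤ F₁ ⊔ F₂)) ''
            {x : F₁ | IsIntegral ℤ x} ∪
          (IntermediateField.inclusion (le_sup_right : F₂ ≤ F₁ ⊔ F₂)) ''
            {x : F₂ | IsIntegral ℤ x}) =
      (integralClosure ℤ ↥(F₁ ⊔ F₂)).toSubring := by
  exact statement10_aux F₁ F₂ n₁ n₂ hn₁ hn₂ hgcd hdeg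

end
end

section
/- Let e be a square-free integer and let F be a number field such that gcd(Disc(F), D) = 1, where D is the discriminant of ℚ(√e). Then K = F(√e) is a quadratic extension of F and O_K = O_F·1 + O_F·ω_e, where ω_e = (1 + √e)/2 if e ≡ 1 (mod 4) and ω_e = √e otherwise. -/
open scoped NumberField TensorProduct
open Finset

noncomputable section

lemma int_dvd_of_dvd {F : Type*} [Field F] [NumberField F] {m n : ℤ}
    (h : (m : 𝓞 F) ∣ (n : 𝓞 F)) : m ∣ n := by
  have h1 := map_dvd (Algebra.norm ℤ) h
  have e1 : ∀ k : ℤ, Algebra.norm ℤ (k : 𝓞 F) = k ^ (Module.finrank ℤ (𝓞 F)) := by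
    intro k
    have := Algebra.norm_algebraMap (S := 𝓞 F) k
    simpa using this
  rw [e1, e1, Int.pow_dvd_pow_iff] at h1
  · exact h1
  · exact (Module.finrank_pos).ne'

lemma dvd_of_dvd_sq {F : Type*} [Field F] [NumberField F] {m : ℤ} (hm : Squarefree m)
    (hd : IsCoprime (NumberField.discr F) m) {x : 𝓞 F} (hx : (m : 𝓞 F) ∣ x ^ 2) :
    (m : 𝓞 F) ∣ x := by
  classical
  have htr : ∀ y : 𝓞 F, m ∣ Algebra.trace ℤ (𝓞 F) (x * y) := by
    intro y
    obtain ⟨w, hw⟩ := hx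
    set b := NumberField.RingOfIntegers.basis F
    let f := (Ideal.Quotient.mk (Ideal.span {m}))
    have hsq : (Algebra.leftMulMatrix b (x * y)) ^ 2
        = m • Algebra.leftMulMatrix b (w * y ^ 2) := by
      rw [← map_pow, ← map_zsmul]
      congr 1
      rw [zsmul_eq_mul, mul_pow, hw]; ring
    have hn : IsNilpotent (f.mapMatrix (Algebra.leftMulMatrix b (x * y))) := by
      refine ⟨2, ?_⟩
      rw [← map_pow, hsq]
      ext i j
      rw [RingHom.mapMatrix_apply, Matrix.map_apply, Matrix.smul_apply, Matrix.zero_apply,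
        Ideal.Quotient.eq_zero_iff_mem, Ideal.mem_span_singleton, smul_eq_mul]
      exact dvd_mul_right _ _
    have h2 := Matrix.isNilpotent_trace_of_isNilpotent hn
    have h3 : Matrix.trace (f.mapMatrix (Algebra.leftMulMatrix b (x * y)))
        = f (Algebra.trace ℤ (𝓞 F) (x * y)) := by
      rw [Algebra.trace_eq_matrix_trace b]
      generalize Algebra.leftMulMatrix b (x * y) = M
      simp [Matrix.trace, f]
    rw [h3] at h2
    obtain ⟨k, hk⟩ := h2
    rw [← map_pow, Ideal.Quotient.eq_zero_iff_mem, Ideal.mem_span_singleton] at hk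
    exact hm.isRadical k _ hk
  set b := NumberField.RingOfIntegers.basis F with hb
  set T := Algebra.traceMatrix ℤ b with hT
  have hdet : T.det = NumberField.discr F := rfl
  have hmul : ∀ i, m ∣ (T.mulVec (b.repr x)) i := by
    intro i
    have : (T.mulVec (b.repr x)) i = Algebra.trace ℤ (𝓞 F) (x * b i) := by
      conv_rhs => rw [← b.sum_repr x]
      rw [Finset.sum_mul, map_sum]
      refine Finset.sum_congr rfl fun j _ => ?_
      rw [smul_mul_assoc, map_zsmul, smul_eq_mul, mul_comm (b j), mul_comm]
      rfl
    rw [this]; exact htr _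
  have hc : ∀ i, m ∣ b.repr x i := by
    intro i
    have h1 : (T.adjugate.mulVec (T.mulVec (b.repr x))) i = T.det * b.repr x i := by
      rw [Matrix.mulVec_mulVec, Matrix.adjugate_mul]
      simp [Matrix.smul_mulVec]
    have h2 : m ∣ T.det * b.repr x i := by
      rw [← h1]
      exact Finset.dvd_sum fun j _ => (hmul j).mul_left _
    rw [hdet] at h2
    exact hd.symm.dvd_of_dvd_mul_left h2
  rw [← b.sum_repr x]
  refine Finset.dvd_sum fun j _ => ?_
  rw [zsmul_eq_mul]
  exact (map_dvd (Int.castRingHom (𝓞 F)) (hc j)).mul_right _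

lemma isIntegral_of_sq {F : Type*} [Field F] [NumberField F] {e : ℤ} (he : Squarefree e)
    (hd : IsCoprime (NumberField.discr F) e) {B : F} (hB : IsIntegral ℤ ((e : F) * B ^ 2)) :
    IsIntegral ℤ B := by
  have he0 : (e : F) ≠ 0 := by exact_mod_cast he.ne_zero
  have h1 : IsIntegral ℤ ((e : F) * B) := by
    refine IsIntegral.of_pow (n := 2) (by norm_num) ?_
    have : ((e : F) * B) ^ 2 = (e : F) * ((e : F) * B ^ 2) := by ring
    rw [this]
    exact (isIntegral_algebraMap (R := ℤ) (A := F) (x := e)).mul hB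
  obtain ⟨C, hC⟩ : ∃ C : 𝓞 F, (C : F) = e * B := ⟨⟨_, h1⟩, rfl⟩
  obtain ⟨M, hM⟩ : ∃ M : 𝓞 F, (M : F) = e * B ^ 2 := ⟨⟨_, hB⟩, rfl⟩
  have h2 : (e : 𝓞 F) ∣ C ^ 2 := by
    refine ⟨M, ?_⟩
    apply NumberField.RingOfIntegers.ext
    simp only [map_pow, map_mul, map_intCast, hC, hM]
    ring
  obtain ⟨c, hc⟩ := dvd_of_dvd_sq he hd h2
  have h3 := congrArg (algebraMap (𝓞 F) F) hc
  simp only [map_mul, map_intCast, hC] at h3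
  rw [mul_right_inj' he0] at h3
  rw [h3]
  exact c.isIntegral_coe

lemma not_sq {F : Type*} [Field F] [NumberField F] {e : ℤ} (he : Squarefree e) (he1 : e ≠ 1)
    (hd : IsCoprime (NumberField.discr F) e)
    (h2 : e % 4 ≠ 1 → IsCoprime (NumberField.discr F) 2) (t : F) : t ^ 2 ≠ (e : F) := by
  intro ht
  have hti : IsIntegral ℤ t := by
    refine IsIntegral.of_pow (n := 2) (by norm_num) ?_
    rw [ht]
    exact (isIntegral_algebraMap (R := ℤ) (A := F) (x := e))
  obtain ⟨u, rfl⟩ : ∃ u : 𝓞 F, algebraMap (𝓞 F) F u = t := ⟨⟨t, hti⟩, rfl⟩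
  have hu : u ^ 2 = (e : 𝓞 F) := by
    apply NumberField.RingOfIntegers.ext
    simpa using ht
  by_cases h3 : e % 4 = 3
  · have hd2 := h2 (by omega)
    obtain ⟨k, hk⟩ : ∃ k, e = 4 * k + 3 := ⟨e / 4, by omega⟩
    have h4 : ((2 : ℤ) : 𝓞 F) ∣ (1 + u) ^ 2 := by
      refine ⟨2 * k + 2 + u, ?_⟩
      have : (1 + u) ^ 2 = 1 + 2 * u + u ^ 2 := by ring
      rw [this, hu, hk]; push_cast; ring
    obtain ⟨c, hc⟩ := dvd_of_dvd_sq Int.prime_two.squarefree hd2 h4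
    have hc' : u = 2 * c - 1 := by push_cast at hc; linear_combination hc
    have h5 : ((4 : ℤ) : 𝓞 F) ∣ ((e - 1 : ℤ) : 𝓞 F) := by
      refine ⟨c ^ 2 - c, ?_⟩
      push_cast
      rw [← hu, hc']; ring
    have := int_dvd_of_dvd h5
    omega
  · obtain ⟨c, hc⟩ := dvd_of_dvd_sq he hd (x := u) (by rw [hu])
    have he0 : (e : 𝓞 F) ≠ 0 := by exact_mod_cast he.ne_zero
    have h6 : (e : 𝓞 F) ∣ ((1 : ℤ) : 𝓞 F) := by
      refine ⟨c ^ 2, mul_left_cancel₀ he0 ?_⟩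
      push_cast
      rw [mul_one]
      conv_lhs => rw [← hu, hc]
      ring
    have := Int.isUnit_iff.1 (isUnit_of_dvd_one (int_dvd_of_dvd h6))
    omega

lemma core_two {F : Type*} [Field F] [NumberField F] {e : ℤ} (he : Squarefree e)
    (h1 : e % 4 ≠ 1) (hd2 : IsCoprime (NumberField.discr F) 2) {A B N : 𝓞 F}
    (h : A ^ 2 - e * B ^ 2 = 4 * N) : (2 : 𝓞 F) ∣ A ∧ (2 : 𝓞 F) ∣ B := by
  have key : ∀ x : 𝓞 F, (2 : 𝓞 F) ∣ x ^ 2 → (2 : 𝓞 F) ∣ x := fun x hx => by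
    simpa using dvd_of_dvd_sq Int.prime_two.squarefree hd2 (x := x) (by simpa using hx)
  have h20 : (2 : 𝓞 F) ≠ 0 := two_ne_zero
  have h0 : e % 4 ≠ 0 := by
    intro h0
    have := he 2 (by omega)
    rw [Int.isUnit_iff] at this
    omega
  rcases (by omega : e % 4 = 2 ∨ e % 4 = 3) with h3 | h3
  · obtain ⟨k, rfl⟩ : ∃ k, e = 4 * k + 2 := ⟨e / 4, by omega⟩
    push_cast at h
    obtain ⟨a, rfl⟩ := key A ⟨2 * N + (2 * k + 1) * B ^ 2, by linear_combination h⟩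
    refine ⟨dvd_mul_right _ _, key B ⟨a ^ 2 - N - k * B ^ 2, mul_left_cancel₀ h20 ?_⟩⟩
    linear_combination -h
  · obtain ⟨k, rfl⟩ : ∃ k, e = 4 * k + 3 := ⟨e / 4, by omega⟩
    push_cast at h
    obtain ⟨c, hc⟩ := key (A + B) ⟨2 * N + (2 * k + 2) * B ^ 2 + A * B, by linear_combination h⟩
    obtain rfl : A = 2 * c - B := by linear_combination hc
    obtain ⟨b, rfl⟩ := key B ⟨c ^ 2 - c * B - N - k * B ^ 2,
      mul_left_cancel₀ h20 (by linear_combination -h)⟩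
    exact ⟨⟨c - b, by ring⟩, dvd_mul_right _ _⟩

/-- Let `e` be a square-free integer (with `ℚ(√e)` quadratic, i.e.
`e ≠ 1`) and `F` a number field with `gcd(Disc F, D) = 1`, where `D` is the discriminant of
`ℚ(√e)` (namely `e` if `e ≡ 1 (mod 4)` and `4e` otherwise).  Then `K = F(√e)` is a
quadratic extension of `F` and `𝓞 K = 𝓞 F · 1 + 𝓞 F · ω_e`, where `ω_e = (1 + √e)/2` if
`e ≡ 1 (mod 4)` and `ω_e = √e` otherwise. -/
theorem statement11 (e : ℤ) (he : Squarefree e) (he1 : e ≠ 1)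
    (F : Type) [Field F] [NumberField F]
    (hgcd : Int.gcd (NumberField.discr F) (if e % 4 = 1 then e else 4 * e) = 1)
    (K : Type) [Field K] [Algebra F K]
    (s : K) (hs : s ^ 2 = (e : K)) (hadj : IntermediateField.adjoin F {s} = ⊤) :
    Module.finrank F K = 2 ∧
    ∀ x : K, IsIntegral ℤ x ↔
      ∃ a b : 𝓞 F, x = algebraMap F K ((a : F)) +
        algebraMap F K ((b : F)) * (if e % 4 = 1 then (1 + s) / 2 else s) := by
  classical
  have hcop : IsCoprime (NumberField.discr F) (if e % 4 = 1 then e else 4 * e) :=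
    Int.isCoprime_iff_gcd_eq_one.2 hgcd
  have hd : IsCoprime (NumberField.discr F) e := by
    split_ifs at hcop
    · exact hcop
    · exact hcop.of_mul_right_right
  have hd2 : e % 4 ≠ 1 → IsCoprime (NumberField.discr F) 2 := by
    intro h
    rw [if_neg h] at hcop
    have h4 : IsCoprime (NumberField.discr F) (2 * 2) := hcop.of_mul_right_left
    exact h4.of_mul_right_left
  have hns := not_sq (F := F) he he1 hd hd2
  have : CharZero K := charZero_of_injective_algebraMap (algebraMap F K).injective
  have hirr : Irreducible (Polynomial.X ^ 2 - Polynomial.C (e : F)) :=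
    (X_pow_sub_C_irreducible_iff_of_prime Nat.prime_two).2 hns
  have hmonic : (Polynomial.X ^ 2 - Polynomial.C (e : F)).Monic :=
    Polynomial.monic_X_pow_sub_C _ (by norm_num)
  have hmin : Polynomial.X ^ 2 - Polynomial.C (e : F) = minpoly F s :=
    minpoly.eq_of_irreducible_of_monic hirr (by simp [hs]) hmonic
  have hsF : IsIntegral F s := ⟨_, hmonic, by rw [← Polynomial.aeval_def]; simp [hs]⟩
  have hsI : IsIntegral ℤ s := by
    refine IsIntegral.of_pow (n := 2) (by norm_num) ?_
    rw [hs]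
    exact (isIntegral_algebraMap (R := ℤ) (A := K) (x := e))
  refine ⟨?_, ?_⟩
  · rw [← IntermediateField.finrank_top', ← hadj, IntermediateField.adjoin.finrank hsF, ← hmin,
      Polynomial.natDegree_X_pow_sub_C]
  obtain ⟨σ, hσ⟩ : ∃ σ : K →ₐ[F] K, σ s = -s := by
    refine IntermediateField.exists_algHom_of_adjoin_splits_of_aeval (S := {s}) ?_ hadj ?_
    · intro s' hs'
      rw [Set.mem_singleton_iff] at hs'
      subst s'
      refine ⟨hsF, ?_⟩
      rw [← hmin]
      have : (Polynomial.X ^ 2 - Polynomial.C (e : F)).map (algebraMap F K)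
          = (Polynomial.X - Polynomial.C s) * (Polynomial.X - Polynomial.C (-s)) := by
        rw [Polynomial.map_sub, Polynomial.map_pow, Polynomial.map_X, Polynomial.map_C,
          map_intCast (algebraMap F K), ← hs, Polynomial.C_neg, Polynomial.C_pow]
        ring
      rw [this]
      exact (Polynomial.Splits.X_sub_C _).mul (Polynomial.Splits.X_sub_C _)
    · rw [← hmin]; simp [hs]
  have hrep : ∀ x : K, ∃ a b : F, x = algebraMap F K a + algebraMap F K b * s := by
    intro x
    have hx : x ∈ IntermediateField.adjoin F {s} := hadj ▸ IntermediateField.mem_top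
    rw [← IntermediateField.mem_toSubalgebra,
      IntermediateField.adjoin_simple_toSubalgebra_of_isAlgebraic hsF.isAlgebraic] at hx
    induction hx using Algebra.adjoin_induction with
    | mem x hx => exact ⟨0, 1, by simpa using hx⟩
    | algebraMap r => exact ⟨r, 0, by simp⟩
    | add x y _ _ hx hy =>
      obtain ⟨a, b, rfl⟩ := hx
      obtain ⟨c, d, rfl⟩ := hy
      exact ⟨a + c, b + d, by simp only [map_add]; ring⟩
    | mul x y _ _ hx hy =>
      obtain ⟨a, b, rfl⟩ := hx
      obtain ⟨c, d, rfl⟩ := hy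
      refine ⟨a * c + b * d * e, a * d + b * c, ?_⟩
      simp only [map_add, map_mul, map_intCast, ← hs]; ring
  have hinj : Function.Injective (algebraMap F K) := (algebraMap F K).injective
  have hdown : ∀ y : F, IsIntegral ℤ (algebraMap F K y) → IsIntegral ℤ y := fun y hy =>
    (isIntegral_algHom_iff ((algebraMap F K).toIntAlgHom) hinj).1 hy
  have hup : ∀ y : 𝓞 F, IsIntegral ℤ (algebraMap F K (y : F)) := fun y =>
    y.isIntegral_coe.map ((algebraMap F K).toIntAlgHom)
  intro x
  constructor
  · intro hx
    obtain ⟨a, b, rfl⟩ := hrep x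
    have hx' := hx.map (σ.toRingHom.toIntAlgHom)
    have hσx : (σ.toRingHom.toIntAlgHom) (algebraMap F K a + algebraMap F K b * s)
        = algebraMap F K a - algebraMap F K b * s := by
      change σ _ = _
      rw [map_add, map_mul, σ.commutes, σ.commutes, hσ]; ring
    rw [hσx] at hx'
    have hA : IsIntegral ℤ (2 * a) := by
      apply hdown
      have h := hx.add hx'
      have h' : algebraMap F K (2 * a) = (algebraMap F K a + algebraMap F K b * s)
          + (algebraMap F K a - algebraMap F K b * s) := by
        simp only [map_mul, map_ofNat]; ring
      rw [h']
      exact h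
    have hN : IsIntegral ℤ (a ^ 2 - e * b ^ 2) := by
      apply hdown
      have h := hx.mul hx'
      have h' : algebraMap F K (a ^ 2 - e * b ^ 2) = (algebraMap F K a + algebraMap F K b * s)
          * (algebraMap F K a - algebraMap F K b * s) := by
        simp only [map_sub, map_mul, map_pow, map_intCast, ← hs]; ring
      rw [h']
      exact h
    have h4 : IsIntegral ℤ (4 : F) := by
      simpa using (isIntegral_algebraMap (R := ℤ) (A := F) (x := 4))
    have hB : IsIntegral ℤ (2 * b) := by
      refine isIntegral_of_sq he hd ?_
      have h := (hA.pow 2).sub (h4.mul hN)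
      have h' : (e : F) * (2 * b) ^ 2 = (2 * a) ^ 2 - 4 * (a ^ 2 - e * b ^ 2) := by ring
      rw [h']
      exact h
    obtain ⟨A, hA⟩ : ∃ A : 𝓞 F, (A : F) = 2 * a := ⟨⟨_, hA⟩, rfl⟩
    obtain ⟨B, hB⟩ : ∃ B : 𝓞 F, (B : F) = 2 * b := ⟨⟨_, hB⟩, rfl⟩
    obtain ⟨N, hN⟩ : ∃ N : 𝓞 F, (N : F) = a ^ 2 - e * b ^ 2 := ⟨⟨_, hN⟩, rfl⟩
    have hABN : A ^ 2 - e * B ^ 2 = 4 * N := by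
      apply NumberField.RingOfIntegers.ext
      simp only [map_sub, map_mul, map_pow, map_intCast, map_ofNat, hA, hB, hN]
      ring
    by_cases h1 : e % 4 = 1
    · simp only [if_pos h1]
      obtain ⟨k, rfl⟩ : ∃ k, e = 4 * k + 1 := ⟨e / 4, by omega⟩
      have ht : IsIntegral ℤ (a - b) := by
        have h5 : IsIntegral (𝓞 F) (a - b) := by
          obtain ⟨M, hM⟩ : ∃ M : 𝓞 F, M = N + k * B ^ 2 := ⟨_, rfl⟩
          refine ⟨Polynomial.X ^ 2 + Polynomial.C B * Polynomial.X
            - Polynomial.C M, by monicity!, ?_⟩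
          simp only [Polynomial.eval₂_add, Polynomial.eval₂_sub, Polynomial.eval₂_mul,
            Polynomial.eval₂_pow, Polynomial.eval₂_X, Polynomial.eval₂_C]
          simp only [hM, map_add, map_mul, map_pow, map_intCast, hB, hN]
          push_cast
          ring
        exact isIntegral_trans _ h5
      obtain ⟨T, hT⟩ : ∃ T : 𝓞 F, (T : F) = a - b := ⟨⟨_, ht⟩, rfl⟩
      refine ⟨T, B, ?_⟩
      rw [hB, hT]
      simp only [map_sub, map_mul, map_ofNat]
      ring
    · simp only [if_neg h1]
      obtain ⟨⟨c, rfl⟩, ⟨d, rfl⟩⟩ := core_two he h1 (hd2 h1) hABN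
      refine ⟨c, d, ?_⟩
      have h20 : (2 : F) ≠ 0 := two_ne_zero
      simp only [map_mul, map_ofNat] at hA hB
      rw [← mul_left_cancel₀ h20 hA, ← mul_left_cancel₀ h20 hB]
  · rintro ⟨a, b, rfl⟩
    refine (hup a).add ((hup b).mul ?_)
    split_ifs with h1
    · obtain ⟨k, rfl⟩ : ∃ k, e = 4 * k + 1 := ⟨e / 4, by omega⟩
      refine ⟨Polynomial.X ^ 2 - Polynomial.X - Polynomial.C k, by monicity!, ?_⟩
      simp only [Polynomial.eval₂_sub, Polynomial.eval₂_pow, Polynomial.eval₂_X,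
        Polynomial.eval₂_C]
      rw [eq_intCast (algebraMap ℤ K)]
      push_cast at hs
      linear_combination hs / 4
    · exact hsI

end
end
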